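/- Under Assumption A, for every x ∈ X^⋄ with x̄_k > 0 for all k ∈ K̄, one has Ξ^□(x̄) ≤ 0, and Ξ^□(x̄) = 0 if and only if x = x^{*,□}. -/

import Mathlib

open scoped BigOperators
open Filter Topology

noncomputable section

variable {I S : Type} [Fintype I] [DecidableEq I] [Fintype S]

/-- The configuration `e_i` consisting of a single type-`i` customer. -/
def econf (i : I) : I → ℕ := Pi.single i 1

/-- `K^s`: the set of nonzero configurations of server type `s`. -/
def Kc (Kbar : S → Finset (I → ℕ)) (s : S) : Finset (I → ℕ) := (Kbar s).erase 0

/-- Monotonicity of the configuration sets. -/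
def KbarMono (Kbar : S → Finset (I → ℕ)) : Prop :=
  ∀ s, ∀ k ∈ Kbar s, ∀ k' : I → ℕ, (∀ i, k' i ≤ k i) → k' ∈ Kbar s

/-- Each configuration set contains the zero configuration. -/
def KbarZero (Kbar : S → Finset (I → ℕ)) : Prop := ∀ s, (0 : I → ℕ) ∈ Kbar s

/-- Every customer type can be served by some server type. -/
def KbarServe (Kbar : S → Finset (I → ℕ)) : Prop := ∀ i : I, ∃ s, econf i ∈ Kbar s

/-- `ℝ_+^K`: nonnegative vectors supported on the nonzero configurations. -/
def orthK (Kbar : S → Finset (I → ℕ)) : Set (S → (I → ℕ) → ℝ) :=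
  {x | (∀ s k, 0 ≤ x s k) ∧ ∀ s, ∀ k, k ∉ Kc Kbar s → x s k = 0}

/-- The feasible set `X` (equality constraints). -/
def feasX (Kbar : S → Finset (I → ℕ)) (ρ : I → ℝ) : Set (S → (I → ℕ) → ℝ) :=
  {x | x ∈ orthK Kbar ∧ ∀ i, ∑ s, ∑ k ∈ Kc Kbar s, (k i : ℝ) * x s k = ρ i}

/-- The relaxed feasible set (inequality constraints). -/
def feasXge (Kbar : S → Finset (I → ℕ)) (ρ : I → ℝ) : Set (S → (I → ℕ) → ℝ) :=
  {x | x ∈ orthK Kbar ∧ ∀ i, ρ i ≤ ∑ s, ∑ k ∈ Kc Kbar s, (k i : ℝ) * x s k}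

/-- The weighted number of occupied servers. -/
def objW (Kbar : S → Finset (I → ℕ)) (γ : S → ℝ) (x : S → (I → ℕ) → ℝ) : ℝ :=
  ∑ s, ∑ k ∈ Kc Kbar s, γ s * x s k

/-- `X*`: optimal solutions of LP=. -/
def XstarSet (Kbar : S → Finset (I → ℕ)) (ρ : I → ℝ) (γ : S → ℝ) :
    Set (S → (I → ℕ) → ℝ) :=
  {x | x ∈ feasX Kbar ρ ∧ ∀ y ∈ feasX Kbar ρ, objW Kbar γ x ≤ objW Kbar γ y}

/-- `X**`: optimal solutions of LP≤. -/
def XstarSetGe (Kbar : S → Finset (I → ℕ)) (ρ : I → ℝ) (γ : S → ℝ) :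
    Set (S → (I → ℕ) → ℝ) :=
  {x | x ∈ feasXge Kbar ρ ∧ ∀ y ∈ feasXge Kbar ρ, objW Kbar γ x ≤ objW Kbar γ y}

/-- `H*`: dual optimal vectors. -/
def HstarSet (Kbar : S → Finset (I → ℕ)) (ρ : I → ℝ) (γ : S → ℝ) : Set (I → ℝ) :=
  {η | ∃ x ∈ feasX Kbar ρ, (∀ i, 0 ≤ η i) ∧
    (∀ s, ∀ k ∈ Kc Kbar s, ∑ i, (k i : ℝ) * η i ≤ γ s) ∧
    (∀ s, ∀ k ∈ Kc Kbar s, (∑ i, (k i : ℝ) * η i) < γ s → x s k = 0)}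

/-- `c_k = ∏_i k_i!`. -/
def ck (k : I → ℕ) : ℝ := ∏ i, (Nat.factorial (k i) : ℝ)

/-- The function `L^{(a)}`. -/
def Lfun (Kbar : S → Finset (I → ℕ)) (a : S → ℝ) (x : S → (I → ℕ) → ℝ) : ℝ :=
  ∑ s, ∑ k ∈ Kc Kbar s, x s k * Real.log (x s k * ck k / (Real.exp 1 * a s))

/-- Product form (infinite-server system). -/
def prodForm (Kbar : S → Finset (I → ℕ)) (a : S → ℝ) (x : S → (I → ℕ) → ℝ)
    (ν : I → ℝ) : Prop :=
  ∀ s, ∀ k ∈ Kc Kbar s, x s k = a s / ck k * Real.exp (∑ i, (k i : ℝ) * ν i)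

/-- ℓ¹ distance on the coordinates indexed by `K`. -/
def distK (Kbar : S → Finset (I → ℕ)) (x y : S → (I → ℕ) → ℝ) : ℝ :=
  ∑ s, ∑ k ∈ Kc Kbar s, |x s k - y s k|

/-- Extended coordinate value: the zero configuration of type `s` has value `a_s`. -/
def xval (a : S → ℝ) (x : S → (I → ℕ) → ℝ) (s : S) (k : I → ℕ) : ℝ :=
  if k = 0 then a s else x s k

/-- `x_{(i)}`: amount of servers available to a type-`i` arrival (GRAND(aZ)). -/
def xavail (Kbar : S → Finset (I → ℕ)) (a : S → ℝ) (x : S → (I → ℕ) → ℝ) (i : I) : ℝ :=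
  ∑ s, ((if econf i ∈ Kc Kbar s then a s else 0)
    + ∑ k ∈ (Kc Kbar s).filter (fun k => k + econf i ∈ Kbar s), x s k)

/-- Departure rate `w_{k i}`. -/
def wrate (μ : I → ℝ) (x : S → (I → ℕ) → ℝ) (s : S) (k : I → ℕ) (i : I) : ℝ :=
  (k i : ℝ) * μ i * x s k

/-- Arrival rate `v_{k i}` (GRAND(aZ)), with `λ_i = μ_i ρ_i`. -/
def vrate (Kbar : S → Finset (I → ℕ)) (a : S → ℝ) (μ ρ : I → ℝ)
    (x : S → (I → ℕ) → ℝ) (s : S) (k : I → ℕ) (i : I) : ℝ :=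
  μ i * ρ i * xval a x s (k - econf i) / xavail Kbar a x i

/-- The GRAND(aZ) fluid vector field `F_k(x)`, for `k ∈ K^s`. -/
def Fdrift (Kbar : S → Finset (I → ℕ)) (a : S → ℝ) (μ ρ : I → ℝ)
    (x : S → (I → ℕ) → ℝ) (s : S) (k : I → ℕ) : ℝ :=
  (∑ i ∈ Finset.univ.filter (fun i : I => 1 ≤ k i ∧ k - econf i ∈ Kbar s),
    (vrate Kbar a μ ρ x s k i - wrate μ x s k i))
  - ∑ i ∈ Finset.univ.filter (fun i : I => k + econf i ∈ Kbar s),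
    (vrate Kbar a μ ρ x s (k + econf i) i - wrate μ x s (k + econf i) i)

/-- The function `Ξ(x)` (GRAND(aZ)). -/
def Xi (Kbar : S → Finset (I → ℕ)) (a : S → ℝ) (μ : I → ℝ)
    (x : S → (I → ℕ) → ℝ) : ℝ :=
  ∑ i : I, ∑ s : S,
    ∑ k ∈ (Kc Kbar s).filter (fun k => 1 ≤ k i ∧ k - econf i ∈ Kbar s),
      ∑ s' : S,
        ∑ k' ∈ (Kc Kbar s').filter (fun k' => 1 ≤ k' i ∧ k' - econf i ∈ Kbar s'),
          (Real.log ((k' i : ℝ) * xval a x s (k - econf i) * x s' k')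
            - Real.log ((k i : ℝ) * x s k * xval a x s' (k' - econf i)))
          * ((k i : ℝ) * μ i * x s k * xval a x s' (k' - econf i) / xavail Kbar a x i)

open Classical in
/-- `Ξ` extended by `−∞` to points with a vanishing coordinate, as a map into `[−∞, 0] ⊆ EReal`. -/
def XiE (Kbar : S → Finset (I → ℕ)) (a : S → ℝ) (μ : I → ℝ)
    (x : S → (I → ℕ) → ℝ) : EReal :=
  if ∀ s, ∀ k ∈ Kc Kbar s, 0 < x s k then ((Xi Kbar a μ x : ℝ) : EReal) else ⊥

/-! Finite-server (GRAND-F) objects. -/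

/-- `X^□`. -/
def XBox (Kbar : S → Finset (I → ℕ)) (h : S → ℝ) : Set (S → (I → ℕ) → ℝ) :=
  {x | x ∈ orthK Kbar ∧ ∀ s, ∑ k ∈ Kc Kbar s, x s k ≤ h s}

/-- `x_{0^s} = h_s − Σ_{k∈K^s} x_k`. -/
def x0 (Kbar : S → Finset (I → ℕ)) (h : S → ℝ) (x : S → (I → ℕ) → ℝ) (s : S) : ℝ :=
  h s - ∑ k ∈ Kc Kbar s, x s k

/-- `X^⋄ = X^□ ∩ X`. -/
def XDiamond (Kbar : S → Finset (I → ℕ)) (h : S → ℝ) (ρ : I → ℝ) :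
    Set (S → (I → ℕ) → ℝ) := XBox Kbar h ∩ feasX Kbar ρ

/-- Assumption A: a feasible point with idle servers of every type. -/
def AssumptionA (Kbar : S → Finset (I → ℕ)) (h : S → ℝ) (ρ : I → ℝ) : Prop :=
  ∃ x ∈ XDiamond Kbar h ρ, ∀ s, 0 < x0 Kbar h x s

/-- The function `L^□`. -/
def LBox (Kbar : S → Finset (I → ℕ)) (h : S → ℝ) (x : S → (I → ℕ) → ℝ) : ℝ :=
  ∑ s, (x0 Kbar h x s * Real.log (x0 Kbar h x s / Real.exp 1)
    + ∑ k ∈ Kc Kbar s, x s k * Real.log (x s k * ck k / Real.exp 1))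

/-- Product form (finite-server system), including the zero configurations. -/
def prodFormBox (Kbar : S → Finset (I → ℕ)) (h : S → ℝ) (x : S → (I → ℕ) → ℝ)
    (ν : I → ℝ) (β : S → ℝ) : Prop :=
  ∀ s, x0 Kbar h x s = Real.exp (-β s) ∧
    ∀ k ∈ Kc Kbar s, x s k = Real.exp (-β s) / ck k * Real.exp (∑ i, (k i : ℝ) * ν i)

/-- Extended coordinate value for the finite-server system. -/
def xvalBox (Kbar : S → Finset (I → ℕ)) (h : S → ℝ) (x : S → (I → ℕ) → ℝ)
    (s : S) (k : I → ℕ) : ℝ :=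
  if k = 0 then x0 Kbar h x s else x s k

/-- `x_{(i)}` for the finite-server system (zero configurations included). -/
def xavailBox (Kbar : S → Finset (I → ℕ)) (h : S → ℝ) (x : S → (I → ℕ) → ℝ)
    (i : I) : ℝ :=
  ∑ s, ((if econf i ∈ Kc Kbar s then x0 Kbar h x s else 0)
    + ∑ k ∈ (Kc Kbar s).filter (fun k => k + econf i ∈ Kbar s), x s k)

/-- Arrival rate `v_{k i}` (GRAND-F), with `λ_i = μ_i ρ_i`. -/
def vrateBox (Kbar : S → Finset (I → ℕ)) (h : S → ℝ) (μ ρ : I → ℝ)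
    (x : S → (I → ℕ) → ℝ) (s : S) (k : I → ℕ) (i : I) : ℝ :=
  μ i * ρ i * xvalBox Kbar h x s (k - econf i) / xavailBox Kbar h x i

/-- The GRAND-F fluid vector field `F^□_k(x)`, for `k ∈ K^s`. -/
def FdriftBox (Kbar : S → Finset (I → ℕ)) (h : S → ℝ) (μ ρ : I → ℝ)
    (x : S → (I → ℕ) → ℝ) (s : S) (k : I → ℕ) : ℝ :=
  (∑ i ∈ Finset.univ.filter (fun i : I => 1 ≤ k i ∧ k - econf i ∈ Kbar s),
    (vrateBox Kbar h μ ρ x s k i - wrate μ x s k i))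
  - ∑ i ∈ Finset.univ.filter (fun i : I => k + econf i ∈ Kbar s),
    (vrateBox Kbar h μ ρ x s (k + econf i) i - wrate μ x s (k + econf i) i)

/-- The function `Ξ^□(x̄)`. -/
def XiBox (Kbar : S → Finset (I → ℕ)) (h : S → ℝ) (μ : I → ℝ)
    (x : S → (I → ℕ) → ℝ) : ℝ :=
  ∑ i : I, ∑ s : S,
    ∑ k ∈ (Kc Kbar s).filter (fun k => 1 ≤ k i ∧ k - econf i ∈ Kbar s),
      ∑ s' : S,
        ∑ k' ∈ (Kc Kbar s').filter (fun k' => 1 ≤ k' i ∧ k' - econf i ∈ Kbar s'),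
          (Real.log ((k' i : ℝ) * xvalBox Kbar h x s (k - econf i) * x s' k')
            - Real.log ((k i : ℝ) * x s k * xvalBox Kbar h x s' (k' - econf i)))
          * ((k i : ℝ) * μ i * x s k * xvalBox Kbar h x s' (k' - econf i)
              / xavailBox Kbar h x i)

/-! ### Elementary inequalities -/

theorem log_sub_log_mul_sub_nonpos {a b : ℝ} (ha : 0 < a) (hb : 0 < b) :
    (Real.log b - Real.log a) * (a - b) ≤ 0 := by
  rcases le_total a b with hab | hab
  · exact mul_nonpos_of_nonneg_of_nonpos (sub_nonneg.2 (Real.log_le_log ha hab))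
      (sub_nonpos.2 hab)
  · exact mul_nonpos_of_nonpos_of_nonneg (sub_nonpos.2 (Real.log_le_log hb hab))
      (sub_nonneg.2 hab)

theorem log_sub_log_mul_sub_eq_zero_iff {a b : ℝ} (ha : 0 < a) (hb : 0 < b) :
    (Real.log b - Real.log a) * (a - b) = 0 ↔ b = a := by
  rw [mul_eq_zero, sub_eq_zero, sub_eq_zero]
  constructor
  · rintro (hlog | hab)
    · exact Real.log_injOn_pos hb ha hlog
    · exact hab.symm
  · rintro rfl
    exact Or.inl rfl

theorem two_mul_sum_log_sub_log_mul {α : Type*} (P : Finset α) (b : α → α → ℝ) :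
    2 * ∑ p ∈ P, ∑ q ∈ P, (Real.log (b p q) - Real.log (b q p)) * b q p
      = ∑ p ∈ P, ∑ q ∈ P, (Real.log (b p q) - Real.log (b q p)) * (b q p - b p q) := by
  have hswap : ∑ p ∈ P, ∑ q ∈ P, (Real.log (b p q) - Real.log (b q p)) * b q p
      = ∑ p ∈ P, ∑ q ∈ P, (Real.log (b q p) - Real.log (b p q)) * b p q := Finset.sum_comm
  rw [two_mul]
  nth_rewrite 2 [hswap]
  simp only [← Finset.sum_add_distrib]
  refine Finset.sum_congr rfl fun p _ => Finset.sum_congr rfl fun q _ => ?_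
  ring

theorem sum_log_sub_log_mul_nonpos {α : Type*} (P : Finset α) (b : α → α → ℝ)
    (hb : ∀ p ∈ P, ∀ q ∈ P, 0 < b p q) :
    ∑ p ∈ P, ∑ q ∈ P, (Real.log (b p q) - Real.log (b q p)) * b q p ≤ 0 := by
  have hsum := two_mul_sum_log_sub_log_mul P b
  have hle : ∑ p ∈ P, ∑ q ∈ P, (Real.log (b p q) - Real.log (b q p)) * (b q p - b p q) ≤ 0 :=
    Finset.sum_nonpos fun p hp => Finset.sum_nonpos fun q hq =>
      log_sub_log_mul_sub_nonpos (hb q hq p hp) (hb p hp q hq)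
  linarith

theorem sum_log_sub_log_mul_eq_zero_iff {α : Type*} (P : Finset α) (b : α → α → ℝ)
    (hb : ∀ p ∈ P, ∀ q ∈ P, 0 < b p q) :
    ∑ p ∈ P, ∑ q ∈ P, (Real.log (b p q) - Real.log (b q p)) * b q p = 0
      ↔ ∀ p ∈ P, ∀ q ∈ P, b p q = b q p := by
  have hsum := two_mul_sum_log_sub_log_mul P b
  have hterm : ∀ p ∈ P, ∀ q ∈ P,
      (Real.log (b p q) - Real.log (b q p)) * (b q p - b p q) ≤ 0 := fun p hp q hq =>
    log_sub_log_mul_sub_nonpos (hb q hq p hp) (hb p hp q hq)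
  rw [show (∑ p ∈ P, ∑ q ∈ P, (Real.log (b p q) - Real.log (b q p)) * b q p = 0)
      ↔ (∑ p ∈ P, ∑ q ∈ P, (Real.log (b p q) - Real.log (b q p)) * (b q p - b p q) = 0) by
    rw [← hsum]; simp,
    Finset.sum_eq_zero_iff_of_nonpos fun p hp => Finset.sum_nonpos (hterm p hp)]
  refine forall₂_congr fun p hp => ?_
  rw [Finset.sum_eq_zero_iff_of_nonpos (hterm p hp)]
  exact forall₂_congr fun q hq =>
    log_sub_log_mul_sub_eq_zero_iff (hb q hq p hp) (hb p hp q hq)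

theorem mul_log_div_exp_one {y c : ℝ} (hc : 0 < c) :
    y * Real.log (y * c / Real.exp 1) = y * Real.log (y * c) - y := by
  rcases eq_or_ne y 0 with rfl | hy
  · simp
  · rw [Real.log_div (mul_ne_zero hy hc.ne') (Real.exp_pos 1).ne', Real.log_exp]
    ring

theorem entropy_tangent_lt {x y c : ℝ} (hx : 0 < x) (hy : 0 ≤ y) (hc : 0 < c) (hne : y ≠ x) :
    (y - x) * Real.log (x * c)
      < y * Real.log (y * c / Real.exp 1) - x * Real.log (x * c / Real.exp 1) := by
  rw [mul_log_div_exp_one hc, mul_log_div_exp_one hc]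
  rcases hy.eq_or_lt with rfl | hy
  · linarith
  · have hlt : Real.log (x / y) < x / y - 1 :=
      Real.log_lt_sub_one_of_pos (div_pos hx hy) fun hxy =>
        hne ((div_eq_one_iff_eq hy.ne').1 hxy).symm
    rw [Real.log_div hx.ne' hy.ne'] at hlt
    rw [Real.log_mul hx.ne' hc.ne', Real.log_mul hy.ne' hc.ne']
    have hmul := mul_lt_mul_of_pos_left hlt hy
    have hcancel : y * (x / y - 1) = x - y := by field_simp
    linarith

theorem entropy_tangent_le {x y c : ℝ} (hx : 0 < x) (hy : 0 ≤ y) (hc : 0 < c) :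
    (y - x) * Real.log (x * c)
      ≤ y * Real.log (y * c / Real.exp 1) - x * Real.log (x * c / Real.exp 1) := by
  rcases eq_or_ne y x with rfl | hne
  · simp
  · exact (entropy_tangent_lt hx hy hc hne).le

theorem hasDerivAt_entropy {y d c : ℝ} (hy : 0 < y) (hc : 0 < c) :
    HasDerivAt (fun t : ℝ => (y + t * d) * Real.log ((y + t * d) * c / Real.exp 1))
      (d * Real.log (y * c)) 0 := by
  have hlin : HasDerivAt (fun t : ℝ => y + t * d) d 0 := by
    simpa using ((hasDerivAt_id (0 : ℝ)).mul_const d).const_add y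
  have harg : HasDerivAt (fun t : ℝ => (y + t * d) * c / Real.exp 1) (d * c / Real.exp 1) 0 :=
    (hlin.mul_const c).div_const _
  have hne : (y + 0 * d) * c / Real.exp 1 ≠ 0 := by
    rw [zero_mul, add_zero]; positivity
  refine (hlin.mul (harg.log hne)).congr_deriv ?_
  simp only [zero_mul, add_zero]
  rw [Real.log_div (by positivity) (Real.exp_pos 1).ne', Real.log_exp]
  field_simp
  ring

/-! ### Configurations -/

omit [DecidableEq I] in
theorem ck_pos (k : I → ℕ) : 0 < ck k :=
  Finset.prod_pos fun i _ => by exact_mod_cast Nat.factorial_pos (k i)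

omit [DecidableEq I] in
theorem ck_zero : ck (0 : I → ℕ) = 1 := by simp [ck]

omit [Fintype I] in
theorem sub_econf_add {k : I → ℕ} {i : I} (hk : 1 ≤ k i) : k - econf i + econf i = k := by
  ext j
  rcases eq_or_ne j i with rfl | hj
  · simp [econf, Nat.sub_add_cancel hk]
  · simp [econf, hj]

theorem ck_add_econf (k : I → ℕ) (i : I) :
    ck (k + econf i) = ((k + econf i) i : ℕ) * ck k := by
  unfold ck
  rw [← Finset.mul_prod_erase _ _ (Finset.mem_univ i),
    ← Finset.mul_prod_erase _ (fun j => ((k j).factorial : ℝ)) (Finset.mem_univ i), ← mul_assoc]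
  congr 1
  · simp [econf, Nat.factorial_succ]
  · refine Finset.prod_congr rfl fun j hj => ?_
    simp [econf, Finset.ne_of_mem_erase hj]

theorem ck_eq_mul_ck_sub_econf {k : I → ℕ} {i : I} (hk : 1 ≤ k i) :
    ck k = (k i : ℝ) * ck (k - econf i) := by
  have hck := ck_add_econf (k - econf i) i
  rwa [sub_econf_add hk] at hck

omit [DecidableEq I] [Fintype S] in
theorem sum_Kbar_eq {Kbar : S → Finset (I → ℕ)} (hzero : KbarZero Kbar) (s : S)
    (f : (I → ℕ) → ℝ) : ∑ k ∈ Kbar s, f k = f 0 + ∑ k ∈ Kc Kbar s, f k :=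
  (Finset.add_sum_erase _ f (hzero s)).symm

/-! ### Extended vectors -/

omit [DecidableEq I] [Fintype S] in
theorem sum_Kc_xvalBox (Kbar : S → Finset (I → ℕ)) (h : S → ℝ) (x : S → (I → ℕ) → ℝ)
    (s : S) (f : (I → ℕ) → ℝ → ℝ) :
    ∑ k ∈ Kc Kbar s, f k (xvalBox Kbar h x s k) = ∑ k ∈ Kc Kbar s, f k (x s k) :=
  Finset.sum_congr rfl fun k hk => by
    rw [xvalBox, if_neg (Finset.ne_of_mem_erase hk)]

omit [DecidableEq I] [Fintype S] in
theorem sum_Kbar_xvalBox {Kbar : S → Finset (I → ℕ)} (hzero : KbarZero Kbar) (h : S → ℝ)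
    (x : S → (I → ℕ) → ℝ) (s : S) : ∑ k ∈ Kbar s, xvalBox Kbar h x s k = h s := by
  rw [sum_Kbar_eq hzero, sum_Kc_xvalBox Kbar h x s fun _ y => y]
  simp [xvalBox, x0]

omit [DecidableEq I] [Fintype S] in
theorem sum_Kbar_mul_xvalBox {Kbar : S → Finset (I → ℕ)} (hzero : KbarZero Kbar) (h : S → ℝ)
    (x : S → (I → ℕ) → ℝ) (s : S) (i : I) :
    ∑ k ∈ Kbar s, (k i : ℝ) * xvalBox Kbar h x s k = ∑ k ∈ Kc Kbar s, (k i : ℝ) * x s k := by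
  rw [sum_Kbar_eq hzero, sum_Kc_xvalBox Kbar h x s fun k y => (k i : ℝ) * y]
  simp

omit [DecidableEq I] in
theorem LBox_eq_sum_Kbar {Kbar : S → Finset (I → ℕ)} (hzero : KbarZero Kbar) (h : S → ℝ)
    (x : S → (I → ℕ) → ℝ) :
    LBox Kbar h x = ∑ s, ∑ k ∈ Kbar s,
      xvalBox Kbar h x s k * Real.log (xvalBox Kbar h x s k * ck k / Real.exp 1) := by
  refine Finset.sum_congr rfl fun s _ => ?_
  rw [sum_Kbar_eq hzero,
    sum_Kc_xvalBox Kbar h x s fun k y => y * Real.log (y * ck k / Real.exp 1)]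
  simp [xvalBox, ck_zero]

omit [DecidableEq I] [Fintype S] in
theorem xvalBox_nonneg {Kbar : S → Finset (I → ℕ)} {h : S → ℝ} {x : S → (I → ℕ) → ℝ}
    (hx : x ∈ XBox Kbar h) (s : S) (k : I → ℕ) : 0 ≤ xvalBox Kbar h x s k := by
  unfold xvalBox
  split_ifs
  · exact sub_nonneg.2 (hx.2 s)
  · exact hx.1.1 s k

omit [DecidableEq I] [Fintype S] in
theorem xvalBox_pos {Kbar : S → Finset (I → ℕ)} {h : S → ℝ} {x : S → (I → ℕ) → ℝ}
    (hpos : ∀ s, ∀ k ∈ Kc Kbar s, 0 < x s k) (hpos0 : ∀ s, 0 < x0 Kbar h x s)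
    (s : S) (k : I → ℕ) (hk : k ∈ Kbar s) : 0 < xvalBox Kbar h x s k := by
  unfold xvalBox
  split_ifs with hk0
  · exact hpos0 s
  · exact hpos s k (Finset.mem_erase.2 ⟨hk0, hk⟩)

omit [DecidableEq I] [Fintype S] in
theorem eq_of_xvalBox_eq {Kbar : S → Finset (I → ℕ)} {h : S → ℝ} {x y : S → (I → ℕ) → ℝ}
    (hx : x ∈ orthK Kbar) (hy : y ∈ orthK Kbar)
    (hxy : ∀ s, ∀ k ∈ Kbar s, xvalBox Kbar h y s k = xvalBox Kbar h x s k) : x = y := by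
  funext s k
  by_cases hk : k ∈ Kc Kbar s
  · have hval := hxy s k (Finset.mem_of_mem_erase hk)
    simpa [xvalBox, Finset.ne_of_mem_erase hk] using hval.symm
  · rw [hx.2 s k hk, hy.2 s k hk]

theorem xavailBox_pos {Kbar : S → Finset (I → ℕ)} (hserve : KbarServe Kbar) {h : S → ℝ}
    {x : S → (I → ℕ) → ℝ} (hpos : ∀ s, ∀ k ∈ Kc Kbar s, 0 < x s k)
    (hpos0 : ∀ s, 0 < x0 Kbar h x s) (i : I) : 0 < xavailBox Kbar h x i := by
  have hrest : ∀ s, 0 ≤ ∑ k ∈ (Kc Kbar s).filter (fun k => k + econf i ∈ Kbar s), x s k :=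
    fun s => Finset.sum_nonneg fun k hk => (hpos s k (Finset.mem_of_mem_filter k hk)).le
  obtain ⟨s, hs⟩ := hserve i
  refine Finset.sum_pos' (fun s _ => add_nonneg ?_ (hrest s)) ⟨s, Finset.mem_univ s, ?_⟩
  · split_ifs
    · exact (hpos0 s).le
    · exact le_rfl
  · have hne : econf i ≠ 0 := by simp [econf]
    have hmem : econf i ∈ Kc Kbar s := Finset.mem_erase.2 ⟨hne, hs⟩
    rw [if_pos hmem]
    exact add_pos_of_pos_of_nonneg (hpos0 s) (hrest s)

/-! ### The log-density of a positive point -/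

/-- `log (x_k c_k)`, the partial derivative of `L^□` in the extended coordinate `k`. -/
def logDensity (Kbar : S → Finset (I → ℕ)) (h : S → ℝ) (x : S → (I → ℕ) → ℝ)
    (s : S) (k : I → ℕ) : ℝ := Real.log (xvalBox Kbar h x s k * ck k)

/-- The pairs `(s, k)` from which a customer of type `i` can depart. -/
def departures (Kbar : S → Finset (I → ℕ)) (i : I) : Finset (Σ _ : S, I → ℕ) :=
  Finset.univ.sigma fun s => (Kc Kbar s).filter fun k => 1 ≤ k i ∧ k - econf i ∈ Kbar s

/-- The product `k'_i x_{k - e_i} x_{k'}`. -/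
def exchange (Kbar : S → Finset (I → ℕ)) (h : S → ℝ) (x : S → (I → ℕ) → ℝ) (i : I)
    (p q : Σ _ : S, I → ℕ) : ℝ :=
  (q.2 i : ℝ) * xvalBox Kbar h x p.1 (p.2 - econf i) * x q.1 q.2

theorem mem_departures {Kbar : S → Finset (I → ℕ)} {i : I} {p : Σ _ : S, I → ℕ} :
    p ∈ departures Kbar i ↔
      p.2 ∈ Kc Kbar p.1 ∧ 1 ≤ p.2 i ∧ p.2 - econf i ∈ Kbar p.1 := by
  simp [departures]

theorem XiBox_eq_sum_departures (Kbar : S → Finset (I → ℕ)) (h : S → ℝ) (μ : I → ℝ)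
    (x : S → (I → ℕ) → ℝ) :
    XiBox Kbar h μ x = ∑ i, μ i / xavailBox Kbar h x i *
      ∑ p ∈ departures Kbar i, ∑ q ∈ departures Kbar i,
        (Real.log (exchange Kbar h x i p q) - Real.log (exchange Kbar h x i q p))
          * exchange Kbar h x i q p := by
  refine Finset.sum_congr rfl fun i _ => ?_
  simp only [departures, Finset.sum_sigma, Finset.mul_sum, exchange]
  refine Finset.sum_congr rfl fun s _ => Finset.sum_congr rfl fun k _ =>
    Finset.sum_congr rfl fun s' _ => Finset.sum_congr rfl fun k' _ => ?_
  rw [mul_right_comm (k i : ℝ) (xvalBox Kbar h x s' (k' - econf i)) (x s k)]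
  ring

theorem exchange_pos {Kbar : S → Finset (I → ℕ)} {h : S → ℝ} {x : S → (I → ℕ) → ℝ}
    (hpos : ∀ s, ∀ k ∈ Kc Kbar s, 0 < x s k) (hpos0 : ∀ s, 0 < x0 Kbar h x s) {i : I}
    {p q : Σ _ : S, I → ℕ} (hp : p ∈ departures Kbar i) (hq : q ∈ departures Kbar i) :
    0 < exchange Kbar h x i p q := by
  rw [mem_departures] at hp hq
  have hqi : (0 : ℝ) < q.2 i := by exact_mod_cast hq.2.1
  exact mul_pos (mul_pos hqi (xvalBox_pos hpos hpos0 _ _ hp.2.2)) (hpos _ _ hq.1)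

theorem log_exchange {Kbar : S → Finset (I → ℕ)} {h : S → ℝ} {x : S → (I → ℕ) → ℝ}
    (hpos : ∀ s, ∀ k ∈ Kc Kbar s, 0 < x s k) (hpos0 : ∀ s, 0 < x0 Kbar h x s) {i : I}
    {p q : Σ _ : S, I → ℕ} (hp : p ∈ departures Kbar i) (hq : q ∈ departures Kbar i) :
    Real.log (exchange Kbar h x i p q)
      = logDensity Kbar h x p.1 (p.2 - econf i) + logDensity Kbar h x q.1 q.2
        - Real.log (ck (p.2 - econf i)) - Real.log (ck (q.2 - econf i)) := by
  rw [mem_departures] at hp hq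
  have hqi : (q.2 i : ℝ) ≠ 0 := by exact_mod_cast (Nat.one_le_iff_ne_zero.1 hq.2.1)
  have hxp := (xvalBox_pos hpos hpos0 _ _ hp.2.2).ne'
  have hxq := (hpos _ _ hq.1).ne'
  have hval : xvalBox Kbar h x q.1 q.2 = x q.1 q.2 := if_neg (Finset.ne_of_mem_erase hq.1)
  rw [exchange, logDensity, logDensity, hval, ck_eq_mul_ck_sub_econf hq.2.1,
    Real.log_mul (mul_ne_zero hqi hxp) hxq, Real.log_mul hqi hxp,
    Real.log_mul hxp (ck_pos _).ne', Real.log_mul hxq (mul_ne_zero hqi (ck_pos _).ne'),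
    Real.log_mul hqi (ck_pos _).ne']
  ring

theorem exchange_symm_iff {Kbar : S → Finset (I → ℕ)} {h : S → ℝ} {x : S → (I → ℕ) → ℝ}
    (hpos : ∀ s, ∀ k ∈ Kc Kbar s, 0 < x s k) (hpos0 : ∀ s, 0 < x0 Kbar h x s) {i : I}
    {p q : Σ _ : S, I → ℕ} (hp : p ∈ departures Kbar i) (hq : q ∈ departures Kbar i) :
    exchange Kbar h x i p q = exchange Kbar h x i q p ↔
      logDensity Kbar h x p.1 p.2 - logDensity Kbar h x p.1 (p.2 - econf i)
        = logDensity Kbar h x q.1 q.2 - logDensity Kbar h x q.1 (q.2 - econf i) := by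
  rw [← Real.log_injOn_pos.eq_iff (exchange_pos hpos hpos0 hp hq) (exchange_pos hpos hpos0 hq hp),
    log_exchange hpos hpos0 hp hq, log_exchange hpos hpos0 hq hp]
  constructor <;> intro heq <;> linarith

theorem XiBox_nonpos {Kbar : S → Finset (I → ℕ)} (hserve : KbarServe Kbar) {h : S → ℝ}
    {μ : I → ℝ} (hμpos : ∀ i, 0 < μ i) {x : S → (I → ℕ) → ℝ}
    (hpos : ∀ s, ∀ k ∈ Kc Kbar s, 0 < x s k) (hpos0 : ∀ s, 0 < x0 Kbar h x s) :
    XiBox Kbar h μ x ≤ 0 := by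
  rw [XiBox_eq_sum_departures]
  refine Finset.sum_nonpos fun i _ => mul_nonpos_of_nonneg_of_nonpos
    (div_pos (hμpos i) (xavailBox_pos hserve hpos hpos0 i)).le ?_
  exact sum_log_sub_log_mul_nonpos _ _ fun p hp q hq => exchange_pos hpos hpos0 hp hq

theorem XiBox_eq_zero_iff {Kbar : S → Finset (I → ℕ)} (hserve : KbarServe Kbar) {h : S → ℝ}
    {μ : I → ℝ} (hμpos : ∀ i, 0 < μ i) {x : S → (I → ℕ) → ℝ}
    (hpos : ∀ s, ∀ k ∈ Kc Kbar s, 0 < x s k) (hpos0 : ∀ s, 0 < x0 Kbar h x s) :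
    XiBox Kbar h μ x = 0 ↔ ∀ i, ∀ p ∈ departures Kbar i, ∀ q ∈ departures Kbar i,
      logDensity Kbar h x p.1 p.2 - logDensity Kbar h x p.1 (p.2 - econf i)
        = logDensity Kbar h x q.1 q.2 - logDensity Kbar h x q.1 (q.2 - econf i) := by
  have hw : ∀ i, 0 < μ i / xavailBox Kbar h x i := fun i =>
    div_pos (hμpos i) (xavailBox_pos hserve hpos hpos0 i)
  have hex : ∀ i, ∀ p ∈ departures Kbar i, ∀ q ∈ departures Kbar i,
      0 < exchange Kbar h x i p q := fun i p hp q hq => exchange_pos hpos hpos0 hp hq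
  rw [XiBox_eq_sum_departures, Finset.sum_eq_zero_iff_of_nonpos fun i _ =>
    mul_nonpos_of_nonneg_of_nonpos (hw i).le (sum_log_sub_log_mul_nonpos _ _ (hex i))]
  simp only [Finset.mem_univ, forall_const]
  refine forall_congr' fun i => ?_
  rw [mul_eq_zero, or_iff_right (hw i).ne', sum_log_sub_log_mul_eq_zero_iff _ _ (hex i)]
  exact forall₂_congr fun p hp => forall₂_congr fun q hq => exchange_symm_iff hpos hpos0 hp hq

/-! ### Product form and minimality -/

theorem logDensity_eq_of_balanced {Kbar : S → Finset (I → ℕ)} (hmono : KbarMono Kbar)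
    (hserve : KbarServe Kbar) {h : S → ℝ} {x : S → (I → ℕ) → ℝ}
    (hbal : ∀ i, ∀ p ∈ departures Kbar i, ∀ q ∈ departures Kbar i,
      logDensity Kbar h x p.1 p.2 - logDensity Kbar h x p.1 (p.2 - econf i)
        = logDensity Kbar h x q.1 q.2 - logDensity Kbar h x q.1 (q.2 - econf i)) :
    ∃ ν : I → ℝ, ∀ s, ∀ k ∈ Kbar s,
      logDensity Kbar h x s k = logDensity Kbar h x s 0 + ∑ i, (k i : ℝ) * ν i := by
  have hdep : ∀ s, ∀ k ∈ Kbar s, ∀ i, 1 ≤ k i →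
      (⟨s, k⟩ : Σ _ : S, I → ℕ) ∈ departures Kbar i := by
    intro s k hk i hi
    refine mem_departures.2 ⟨Finset.mem_erase.2 ⟨?_, hk⟩, hi,
      hmono s k hk _ fun j => Nat.sub_le _ _⟩
    rintro rfl
    simp at hi
  choose σ hσ using hserve
  refine ⟨fun i => logDensity Kbar h x (σ i) (econf i)
    - logDensity Kbar h x (σ i) (econf i - econf i), fun s k hk => ?_⟩
  induction hn : ∑ i, k i generalizing k with
  | zero =>
    have hk0 : k = 0 := by
      funext i
      exact Finset.sum_eq_zero_iff.1 hn i (Finset.mem_univ i)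
    simp [hk0]
  | succ n ih =>
    obtain ⟨i, hi⟩ : ∃ i, 1 ≤ k i := by
      by_contra! hlt
      rw [Finset.sum_eq_zero fun i _ => Nat.lt_one_iff.1 (hlt i)] at hn
      omega
    have hstep := hbal i _ (hdep s k hk i hi) _
      (hdep (σ i) (econf i) (hσ i) i (by simp [econf]))
    dsimp only at hstep
    have hki : ∀ j, k j = (k - econf i) j + econf i j := fun j =>
      (congrFun (sub_econf_add hi) j).symm
    have hsum : ∑ j, (k - econf i) j = n := by
      have hsplit : ∑ j, k j = ∑ j, (k - econf i) j + ∑ j, econf i j := by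
        rw [← Finset.sum_add_distrib]
        exact Finset.sum_congr rfl fun j _ => hki j
      have hone : ∑ j, econf i j = 1 := by simp [econf]
      omega
    have hprev := ih (k - econf i) (hmono s k hk _ fun j => Nat.sub_le _ _) hsum
    rw [Finset.sum_congr rfl fun j _ => by rw [hki j, Nat.cast_add, add_mul],
      Finset.sum_add_distrib, ← add_assoc, ← hprev, ← sub_eq_iff_eq_add', hstep]
    simp [econf, Pi.single_apply]

theorem eq_minimizer_of_balanced {Kbar : S → Finset (I → ℕ)} (hmono : KbarMono Kbar)
    (hzero : KbarZero Kbar) (hserve : KbarServe Kbar) {ρ : I → ℝ} {h : S → ℝ}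
    {x y : S → (I → ℕ) → ℝ} (hy : y ∈ XDiamond Kbar h ρ) (hx : x ∈ XDiamond Kbar h ρ)
    (hle : LBox Kbar h y ≤ LBox Kbar h x)
    (hpos : ∀ s, ∀ k ∈ Kc Kbar s, 0 < x s k) (hpos0 : ∀ s, 0 < x0 Kbar h x s)
    (hbal : ∀ i, ∀ p ∈ departures Kbar i, ∀ q ∈ departures Kbar i,
      logDensity Kbar h x p.1 p.2 - logDensity Kbar h x p.1 (p.2 - econf i)
        = logDensity Kbar h x q.1 q.2 - logDensity Kbar h x q.1 (q.2 - econf i)) :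
    x = y := by
  obtain ⟨ν, hν⟩ := logDensity_eq_of_balanced hmono hserve hbal
  have hmass : ∀ z : S → (I → ℕ) → ℝ, z ∈ XDiamond Kbar h ρ →
      ∑ s, ∑ k ∈ Kbar s, xvalBox Kbar h z s k * logDensity Kbar h x s k
        = ∑ s, h s * logDensity Kbar h x s 0 + ∑ i, ρ i * ν i := by
    intro z hz
    calc ∑ s, ∑ k ∈ Kbar s, xvalBox Kbar h z s k * logDensity Kbar h x s k
        = ∑ s, ∑ k ∈ Kbar s, (xvalBox Kbar h z s k * logDensity Kbar h x s 0
            + ∑ i, (k i : ℝ) * xvalBox Kbar h z s k * ν i) := by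
          refine Finset.sum_congr rfl fun s _ => Finset.sum_congr rfl fun k hk => ?_
          rw [hν s k hk, mul_add, Finset.mul_sum]
          congr 1
          exact Finset.sum_congr rfl fun i _ => by ring
      _ = ∑ s, h s * logDensity Kbar h x s 0
            + ∑ i, (∑ s, ∑ k ∈ Kbar s, (k i : ℝ) * xvalBox Kbar h z s k) * ν i := by
          simp only [Finset.sum_add_distrib, ← Finset.sum_mul, sum_Kbar_xvalBox hzero]
          congr 1
          rw [Finset.sum_congr rfl fun s _ => Finset.sum_comm, Finset.sum_comm]
          simp only [Finset.sum_mul]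
      _ = _ := by
          congr 1
          refine Finset.sum_congr rfl fun i _ => ?_
          simp only [sum_Kbar_mul_xvalBox hzero]
          rw [hz.2.2 i]
  have hxpos := xvalBox_pos hpos hpos0
  have htangent : ∀ s, ∀ k ∈ Kbar s,
      (xvalBox Kbar h y s k - xvalBox Kbar h x s k) * logDensity Kbar h x s k
        ≤ xvalBox Kbar h y s k * Real.log (xvalBox Kbar h y s k * ck k / Real.exp 1)
          - xvalBox Kbar h x s k * Real.log (xvalBox Kbar h x s k * ck k / Real.exp 1) :=
    fun s k hk => entropy_tangent_le (hxpos s k hk) (xvalBox_nonneg hy.1 s k) (ck_pos k)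
  refine eq_of_xvalBox_eq hx.1.1 hy.1.1 (h := h) fun s k hk => ?_
  by_contra hne
  have hlt : ∑ s, ∑ k ∈ Kbar s,
      (xvalBox Kbar h y s k - xvalBox Kbar h x s k) * logDensity Kbar h x s k
        < ∑ s, ∑ k ∈ Kbar s,
          (xvalBox Kbar h y s k * Real.log (xvalBox Kbar h y s k * ck k / Real.exp 1)
          - xvalBox Kbar h x s k * Real.log (xvalBox Kbar h x s k * ck k / Real.exp 1)) :=
    Finset.sum_lt_sum (fun s _ => Finset.sum_le_sum (htangent s))
      ⟨s, Finset.mem_univ s, Finset.sum_lt_sum (htangent s)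
        ⟨k, hk, entropy_tangent_lt (hxpos s k hk) (xvalBox_nonneg hy.1 s k) (ck_pos k) hne⟩⟩
  simp only [sub_mul, Finset.sum_sub_distrib, ← LBox_eq_sum_Kbar hzero, hmass y hy,
    hmass x hx, sub_self] at hlt
  linarith

/-- The point `x + t d`, with the zero configurations left implicit. -/
def perturb (Kbar : S → Finset (I → ℕ)) (x d : S → (I → ℕ) → ℝ) (t : ℝ) :
    S → (I → ℕ) → ℝ :=
  fun s k => if k ∈ Kc Kbar s then x s k + t * d s k else 0

omit [DecidableEq I] [Fintype S] in
theorem xvalBox_perturb {Kbar : S → Finset (I → ℕ)} (hzero : KbarZero Kbar) (h : S → ℝ)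
    (x : S → (I → ℕ) → ℝ) {d : S → (I → ℕ) → ℝ} (hd : ∀ s, ∑ k ∈ Kbar s, d s k = 0) (t : ℝ)
    (s : S) (k : I → ℕ) (hk : k ∈ Kbar s) :
    xvalBox Kbar h (perturb Kbar x d t) s k = xvalBox Kbar h x s k + t * d s k := by
  unfold xvalBox
  split_ifs with hk0
  · have hds := hd s
    rw [sum_Kbar_eq hzero] at hds
    have hsum : ∑ k ∈ Kc Kbar s, perturb Kbar x d t s k
        = ∑ k ∈ Kc Kbar s, x s k + t * ∑ k ∈ Kc Kbar s, d s k := by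
      rw [Finset.mul_sum, ← Finset.sum_add_distrib]
      exact Finset.sum_congr rfl fun k hk => if_pos hk
    rw [x0, x0, hsum, hk0, eq_neg_of_add_eq_zero_left hds]
    ring
  · exact if_pos (Finset.mem_erase.2 ⟨hk0, hk⟩)

omit [DecidableEq I] in
theorem perturb_mem_XDiamond {Kbar : S → Finset (I → ℕ)} (hzero : KbarZero Kbar) {h : S → ℝ}
    {ρ : I → ℝ} {x d : S → (I → ℕ) → ℝ} (hx : x ∈ XDiamond Kbar h ρ)
    (hd : ∀ s, ∑ k ∈ Kbar s, d s k = 0)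
    (hdρ : ∀ i, ∑ s, ∑ k ∈ Kbar s, d s k * (k i : ℝ) = 0) {t : ℝ}
    (ht : ∀ s, ∀ k ∈ Kbar s, 0 ≤ xvalBox Kbar h x s k + t * d s k) :
    perturb Kbar x d t ∈ XDiamond Kbar h ρ := by
  have hval := xvalBox_perturb hzero h x hd t
  have horth : perturb Kbar x d t ∈ orthK Kbar := by
    refine ⟨fun s k => ?_, fun s k hk => if_neg hk⟩
    by_cases hk : k ∈ Kc Kbar s
    · have hkbar := Finset.mem_of_mem_erase hk
      have hnonneg := ht s k hkbar
      rwa [← hval s k hkbar, xvalBox, if_neg (Finset.ne_of_mem_erase hk)] at hnonneg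
    · exact (if_neg hk).ge
  refine ⟨⟨horth, fun s => ?_⟩, horth, fun i => ?_⟩
  · have hnonneg := ht s 0 (hzero s)
    rw [← hval s 0 (hzero s), xvalBox, if_pos rfl] at hnonneg
    exact sub_nonneg.1 hnonneg
  · rw [← hx.2.2 i]
    simp only [← sum_Kbar_mul_xvalBox hzero h]
    rw [← sub_eq_zero, ← mul_zero t, ← hdρ i, Finset.mul_sum, ← Finset.sum_sub_distrib]
    refine Finset.sum_congr rfl fun s _ => ?_
    rw [Finset.mul_sum, ← Finset.sum_sub_distrib]
    refine Finset.sum_congr rfl fun k hk => ?_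
    rw [hval s k hk]
    ring

omit [DecidableEq I] in
theorem sum_mul_logDensity_eq_zero_of_minimizer {Kbar : S → Finset (I → ℕ)}
    (hzero : KbarZero Kbar) {ρ : I → ℝ} {h : S → ℝ} {x d : S → (I → ℕ) → ℝ}
    (hx : x ∈ XDiamond Kbar h ρ) (hmin : ∀ y ∈ XDiamond Kbar h ρ, LBox Kbar h x ≤ LBox Kbar h y)
    (hpos : ∀ s, ∀ k ∈ Kc Kbar s, 0 < x s k) (hpos0 : ∀ s, 0 < x0 Kbar h x s)
    (hd : ∀ s, ∑ k ∈ Kbar s, d s k = 0)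
    (hdρ : ∀ i, ∑ s, ∑ k ∈ Kbar s, d s k * (k i : ℝ) = 0) :
    ∑ s, ∑ k ∈ Kbar s, d s k * logDensity Kbar h x s k = 0 := by
  have hxpos := xvalBox_pos hpos hpos0
  have hderiv : HasDerivAt (fun t : ℝ => ∑ s, ∑ k ∈ Kbar s,
      (xvalBox Kbar h x s k + t * d s k)
        * Real.log ((xvalBox Kbar h x s k + t * d s k) * ck k / Real.exp 1))
      (∑ s, ∑ k ∈ Kbar s, d s k * logDensity Kbar h x s k) 0 :=
    HasDerivAt.fun_sum fun s _ => HasDerivAt.fun_sum fun k hk =>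
      hasDerivAt_entropy (hxpos s k hk) (ck_pos k)
  refine IsLocalMin.hasDerivAt_eq_zero ?_ hderiv
  have hev : ∀ᶠ t : ℝ in 𝓝 0, ∀ s, ∀ k ∈ Kbar s, 0 ≤ xvalBox Kbar h x s k + t * d s k := by
    refine eventually_all.2 fun s => (Finset.eventually_all _).2 fun k hk => ?_
    have hcont : Continuous fun t : ℝ => xvalBox Kbar h x s k + t * d s k := by fun_prop
    refine (hcont.tendsto 0).eventually (eventually_ge_nhds ?_)
    simpa using hxpos s k hk
  filter_upwards [hev] with t ht
  have hle := hmin _ (perturb_mem_XDiamond hzero hx hd hdρ ht)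
  rw [LBox_eq_sum_Kbar hzero, LBox_eq_sum_Kbar hzero h (perturb Kbar x d t)] at hle
  simp only [zero_mul, add_zero]
  refine hle.trans_eq ?_
  refine Finset.sum_congr rfl fun s _ => Finset.sum_congr rfl fun k hk => ?_
  rw [xvalBox_perturb hzero h x hd t s k hk]

open Classical in
/-- The indicator of the extended coordinate `(s₀, k₀)`. -/
def unitDir (s₀ : S) (k₀ : I → ℕ) (s : S) (k : I → ℕ) : ℝ :=
  if s = s₀ then if k = k₀ then 1 else 0 else 0

omit [DecidableEq I] [Fintype S] in
open Classical in
theorem sum_Kbar_unitDir_mul {Kbar : S → Finset (I → ℕ)} {s₀ : S} {k₀ : I → ℕ}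
    (hk₀ : k₀ ∈ Kbar s₀) (f : S → (I → ℕ) → ℝ) (s : S) :
    ∑ k ∈ Kbar s, unitDir s₀ k₀ s k * f s k = if s = s₀ then f s₀ k₀ else 0 := by
  unfold unitDir
  split_ifs with hs
  · subst hs
    simp [hk₀]
  · simp

omit [DecidableEq I] in
theorem sum_unitDir_mul {Kbar : S → Finset (I → ℕ)} {s₀ : S} {k₀ : I → ℕ}
    (hk₀ : k₀ ∈ Kbar s₀) (f : S → (I → ℕ) → ℝ) :
    ∑ s, ∑ k ∈ Kbar s, unitDir s₀ k₀ s k * f s k = f s₀ k₀ := by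
  classical
  simp [sum_Kbar_unitDir_mul hk₀]

theorem balanced_of_minimizer {Kbar : S → Finset (I → ℕ)}
    (hzero : KbarZero Kbar) {ρ : I → ℝ} {h : S → ℝ} {x : S → (I → ℕ) → ℝ}
    (hx : x ∈ XDiamond Kbar h ρ) (hmin : ∀ y ∈ XDiamond Kbar h ρ, LBox Kbar h x ≤ LBox Kbar h y)
    (hpos : ∀ s, ∀ k ∈ Kc Kbar s, 0 < x s k) (hpos0 : ∀ s, 0 < x0 Kbar h x s) {i : I}
    {p q : Σ _ : S, I → ℕ} (hp : p ∈ departures Kbar i) (hq : q ∈ departures Kbar i) :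
    logDensity Kbar h x p.1 p.2 - logDensity Kbar h x p.1 (p.2 - econf i)
      = logDensity Kbar h x q.1 q.2 - logDensity Kbar h x q.1 (q.2 - econf i) := by
  classical
  rw [mem_departures] at hp hq
  have hpK := Finset.mem_of_mem_erase hp.1
  have hqK := Finset.mem_of_mem_erase hq.1
  have hstat := sum_mul_logDensity_eq_zero_of_minimizer hzero hx hmin hpos hpos0
    (d := fun s k => unitDir p.1 p.2 s k - unitDir p.1 (p.2 - econf i) s k
      - (unitDir q.1 q.2 s k - unitDir q.1 (q.2 - econf i) s k)) ?_ ?_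
  · simp only [sub_mul, Finset.sum_sub_distrib, sum_unitDir_mul hpK, sum_unitDir_mul hqK,
      sum_unitDir_mul hp.2.2, sum_unitDir_mul hq.2.2] at hstat
    linarith
  · intro s
    have hsum : ∀ {s₀ : S} {k₀ : I → ℕ}, k₀ ∈ Kbar s₀ →
        ∑ k ∈ Kbar s, unitDir s₀ k₀ s k = if s = s₀ then 1 else 0 := fun hk₀ => by
      simpa using sum_Kbar_unitDir_mul hk₀ (fun _ _ => 1) s
    simp only [Finset.sum_sub_distrib, hsum hpK, hsum hqK, hsum hp.2.2, hsum hq.2.2, sub_self]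
  · intro j
    have hsum : ∀ {s₀ : S} {k₀ : I → ℕ}, k₀ ∈ Kbar s₀ →
        ∑ s, ∑ k ∈ Kbar s, unitDir s₀ k₀ s k * (k j : ℝ) = k₀ j := fun hk₀ =>
      sum_unitDir_mul hk₀ fun _ k => (k j : ℝ)
    have hcast : ∀ {k : I → ℕ}, 1 ≤ k i →
        (k j : ℝ) - ((k - econf i) j : ℕ) = (econf i j : ℕ) := fun hk => by
      rw [sub_eq_iff_eq_add', ← Nat.cast_add, ← Pi.add_apply, sub_econf_add hk]
    simp only [sub_mul, Finset.sum_sub_distrib, hsum hpK, hsum hqK, hsum hp.2.2, hsum hq.2.2,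
      hcast hp.2.1, hcast hq.2.1, sub_self]

/-- `Ξ^□(x̄) ≤ 0` on strictly positive points of `X^⋄`, with equality iff
`x = x^{*,□}`. -/
theorem XiBox_nonpos_eq_zero_iff_minimizer
    (Kbar : S → Finset (I → ℕ))
    (hmono : KbarMono Kbar) (hzero : KbarZero Kbar) (hserve : KbarServe Kbar)
    (ρ : I → ℝ) (hρpos : ∀ i, 0 < ρ i) (hρsum : ∑ i, ρ i = 1)
    (h : S → ℝ) (hhpos : ∀ s, 0 < h s)
    (μ : I → ℝ) (hμpos : ∀ i, 0 < μ i)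
    (hA : AssumptionA Kbar h ρ)
    (xB : S → (I → ℕ) → ℝ) (hxB : xB ∈ XDiamond Kbar h ρ)
    (hminB : ∀ y ∈ XDiamond Kbar h ρ, LBox Kbar h xB ≤ LBox Kbar h y)
    (x : S → (I → ℕ) → ℝ) (hx : x ∈ XDiamond Kbar h ρ)
    (hpos : ∀ s, ∀ k ∈ Kc Kbar s, 0 < x s k)
    (hpos0 : ∀ s, 0 < x0 Kbar h x s) :
    XiBox Kbar h μ x ≤ 0 ∧ (XiBox Kbar h μ x = 0 ↔ x = xB) := by
  refine ⟨XiBox_nonpos hserve hμpos hpos hpos0, ?_⟩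
  rw [XiBox_eq_zero_iff hserve hμpos hpos hpos0]
  constructor
  · exact eq_minimizer_of_balanced hmono hzero hserve hxB hx (hminB x hx) hpos hpos0
  · rintro rfl i p hp q hq
    exact balanced_of_minimizer hzero hx hminB hpos hpos0 hp hq
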